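/- For any PIMP commands c1, c2, environment ρ and memory m: if σ is a terminable execution of the concrete configuration ⟨c1 ∥ c2⟩_k⟨ρ⟩_env⟨m⟩_mem, then σ can be broken down into two terminable executions σ1 and σ2, which are executions of the concrete configurations ⟨c1⟩_k⟨ρ⟩_env⟨m⟩_mem and ⟨c2⟩_k⟨ρ⟩_env⟨m⟩_mem respectively; concretely, at each step of σ where the i-th configuration is ⟨c1i ∥ c2i⟩_k⟨ρi⟩_env⟨mi⟩_mem, σ1 has configuration ⟨c1i⟩_k⟨ρi⟩_env⟨mi⟩_mem and σ2 has configuration ⟨c2i⟩_k⟨ρi⟩_env⟨mi⟩_mem, each P-step of σ derived by PAR1 (resp. PAR2) becoming a P-step of σ1 (resp. σ2) and an E-step of the other, and each E-step of σ becoming E-steps of both. -/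

import Mathlib

set_option autoImplicit false

namespace PIMP

/-! ### Basic domains -/

abbrev PVar := String
abbrev SVar := String

/-- Environments: partial maps from program variables to integers. -/
abbrev Env := PVar → Option ℤ
/-- Memories: partial maps from (positive) integer addresses to integers. -/
abbrev Mem := ℤ → Option ℤ

def envUpd (ρ : Env) (x : PVar) (v : Option ℤ) : Env :=
  fun y => if y = x then v else ρ y

def memUpd (m : Mem) (a : ℤ) (v : Option ℤ) : Mem :=
  fun b => if b = a then v else m b

def memUpdO (m : Mem) (a : Option ℤ) (v : Option ℤ) : Mem :=
  fun b => if some b = a then v else m b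

def memStore (m : Mem) : ℤ → List (Option ℤ) → Mem
  | _, [] => m
  | p, v :: vs => fun b => if b = p then v else memStore m (p + 1) vs b

/-! ### Syntax -/

inductive AExp where
  | num : ℤ → AExp
  | var : PVar → AExp
  | neg : AExp → AExp
  | add : AExp → AExp → AExp
  | sub : AExp → AExp → AExp
  | mul : AExp → AExp → AExp
  | div : AExp → AExp → AExp
  | mod : AExp → AExp → AExp

def aeval (ρ : Env) : AExp → Option ℤ
  | AExp.num n => some n
  | AExp.var x => ρ x
  | AExp.neg e => (aeval ρ e).map (fun v => -v)
  | AExp.add e1 e2 => Option.map₂ (· + ·) (aeval ρ e1) (aeval ρ e2)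
  | AExp.sub e1 e2 => Option.map₂ (· - ·) (aeval ρ e1) (aeval ρ e2)
  | AExp.mul e1 e2 => Option.map₂ (· * ·) (aeval ρ e1) (aeval ρ e2)
  | AExp.div e1 e2 => Option.map₂ (· / ·) (aeval ρ e1) (aeval ρ e2)
  | AExp.mod e1 e2 => Option.map₂ (· % ·) (aeval ρ e1) (aeval ρ e2)

inductive BExp where
  | tt : BExp
  | ff : BExp
  | eq : AExp → AExp → BExp
  | ne : AExp → AExp → BExp
  | lt : AExp → AExp → BExp
  | gt : AExp → AExp → BExp

def beval (ρ : Env) : BExp → Option Bool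
  | BExp.tt => some true
  | BExp.ff => some false
  | BExp.eq e1 e2 => Option.map₂ (fun a b => decide (a = b)) (aeval ρ e1) (aeval ρ e2)
  | BExp.ne e1 e2 => Option.map₂ (fun a b => decide (a ≠ b)) (aeval ρ e1) (aeval ρ e2)
  | BExp.lt e1 e2 => Option.map₂ (fun a b => decide (a < b)) (aeval ρ e1) (aeval ρ e2)
  | BExp.gt e1 e2 => Option.map₂ (fun a b => decide (b < a)) (aeval ρ e1) (aeval ρ e2)

/-- PIMP commands. -/
inductive Com where
  | skip : Com
  | assign : PVar → AExp → Com                -- x := e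
  | arrRead : PVar → PVar → AExp → Com        -- x := A[e]
  | arrWrite : PVar → AExp → AExp → Com       -- A[e1] := e2
  | mkArray : PVar → List AExp → Com          -- A := Array(ē)
  | cond : BExp → Com → Com → Com             -- if (b) c1 else c2
  | seq : Com → Com → Com                     -- c1 ; c2
  | whileDo : BExp → Com → Com                -- while b do c
  | par : Com → Com → Com                     -- c1 ∥ c2
  | await : BExp → Com → Com                  -- await b then cc

/-- The sort `CC`: commands containing no `∥`, `while` or `await`. -/
def IsCC : Com → Prop
  | Com.cond _ c1 c2 => IsCC c1 ∧ IsCC c2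
  | Com.seq c1 c2 => IsCC c1 ∧ IsCC c2
  | Com.whileDo _ _ => False
  | Com.par _ _ => False
  | Com.await _ _ => False
  | _ => True

/-- Computations: either the empty computation `·` (`none`) or a command. -/
abbrev K := Option Com

/-- `·;c = c`. -/
def seqK : K → Com → K
  | none, c => some c
  | some c1, c => some (Com.seq c1 c)

/-- `·∥c = c = c∥·`. -/
def parK : K → K → K
  | none, k => k
  | some c1, none => some c1
  | some c1, some c2 => some (Com.par c1 c2)

/-- Concrete configurations `⟨k⟩_k⟨ρ⟩_env⟨m⟩_mem`. -/
structure Cfg where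
  k : K
  env : Env
  mem : Mem

inductive Label where
  | P : Label
  | E : Label

/-! ### Operational semantics (Figure 2) -/

mutual

inductive Step : Label → Cfg → Cfg → Prop where
  | skip (ρ : Env) (m : Mem) :
      Step Label.P ⟨some Com.skip, ρ, m⟩ ⟨none, ρ, m⟩
  | seq {c1 : Com} (c2 : Com) {k1' : K} {ρ ρ' : Env} {m m' : Mem} :
      Step Label.P ⟨some c1, ρ, m⟩ ⟨k1', ρ', m'⟩ →
      Step Label.P ⟨some (Com.seq c1 c2), ρ, m⟩ ⟨seqK k1' c2, ρ', m'⟩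
  | asgn1 {x : PVar} {e : AExp} {ρ : Env} {m : Mem} {v : ℤ} :
      aeval ρ e = some v →
      Step Label.P ⟨some (Com.assign x e), ρ, m⟩ ⟨none, envUpd ρ x (some v), m⟩
  | asgn2 {x A : PVar} {e : AExp} {ρ : Env} {m : Mem} {q p v : ℤ} :
      ρ A = some q → aeval ρ e = some p → m (q + p) = some v →
      Step Label.P ⟨some (Com.arrRead x A e), ρ, m⟩ ⟨none, envUpd ρ x (some v), m⟩
  | asgn3 {A : PVar} {e1 e2 : AExp} {ρ : Env} {m : Mem} {q p v : ℤ} :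
      ρ A = some q → aeval ρ e1 = some p → aeval ρ e2 = some v →
      (m (q + p)).isSome →
      Step Label.P ⟨some (Com.arrWrite A e1 e2), ρ, m⟩ ⟨none, ρ, memUpd m (q + p) (some v)⟩
  | array {A : PVar} {es : List AExp} {ρ : Env} {m : Mem} {vs : List ℤ} {p : ℤ} :
      es.map (aeval ρ) = vs.map some → 0 < p →
      (∀ i : ℕ, i < es.length → m (p + (i : ℤ)) = none) →
      Step Label.P ⟨some (Com.mkArray A es), ρ, m⟩
        ⟨none, envUpd ρ A (some p), memStore m p (vs.map some)⟩
  | if1 {b : BExp} {c1 c2 : Com} {ρ : Env} {m : Mem} :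
      beval ρ b = some true →
      Step Label.P ⟨some (Com.cond b c1 c2), ρ, m⟩ ⟨some c1, ρ, m⟩
  | if2 {b : BExp} {c1 c2 : Com} {ρ : Env} {m : Mem} :
      beval ρ b = some false →
      Step Label.P ⟨some (Com.cond b c1 c2), ρ, m⟩ ⟨some c2, ρ, m⟩
  | while1 {b : BExp} {c : Com} {ρ : Env} {m : Mem} :
      beval ρ b = some true →
      Step Label.P ⟨some (Com.whileDo b c), ρ, m⟩
        ⟨some (Com.seq c (Com.whileDo b c)), ρ, m⟩
  | while2 {b : BExp} {c : Com} {ρ : Env} {m : Mem} :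
      beval ρ b = some false →
      Step Label.P ⟨some (Com.whileDo b c), ρ, m⟩ ⟨none, ρ, m⟩
  | await {b : BExp} {cc : Com} {ρ ρ' : Env} {m m' : Mem} :
      beval ρ b = some true → IsCC cc →
      PSteps ⟨some cc, ρ, m⟩ ⟨none, ρ', m'⟩ →
      Step Label.P ⟨some (Com.await b cc), ρ, m⟩ ⟨none, ρ', m'⟩
  | par1 {c1 : Com} (c2 : Com) {k1' : K} {ρ ρ' : Env} {m m' : Mem} :
      Step Label.P ⟨some c1, ρ, m⟩ ⟨k1', ρ', m'⟩ →
      Step Label.P ⟨some (Com.par c1 c2), ρ, m⟩ ⟨parK k1' (some c2), ρ', m'⟩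
  | par2 (c1 : Com) {c2 : Com} {k2' : K} {ρ ρ' : Env} {m m' : Mem} :
      Step Label.P ⟨some c2, ρ, m⟩ ⟨k2', ρ', m'⟩ →
      Step Label.P ⟨some (Com.par c1 c2), ρ, m⟩ ⟨parK (some c1) k2', ρ', m'⟩
  | env (k : K) (ρ ρ' : Env) (m m' : Mem) :
      Step Label.E ⟨k, ρ, m⟩ ⟨k, ρ', m'⟩

/-- Reflexive-transitive closure of program steps (used by the AWAIT rule). -/
inductive PSteps : Cfg → Cfg → Prop where
  | refl (γ : Cfg) : PSteps γ γ
  | head {γ γ' γ'' : Cfg} : Step Label.P γ γ' → PSteps γ' γ'' → PSteps γ γ''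

end

/-- A step of either label: `γ →L γ'`. -/
def LStep (γ γ' : Cfg) : Prop := ∃ L : Label, Step L γ γ'

/-- `γ →L^n γ'`. -/
inductive LStepN : ℕ → Cfg → Cfg → Prop where
  | zero (γ : Cfg) : LStepN 0 γ γ
  | succ {n : ℕ} {γ γ' γ'' : Cfg} : LStep γ γ' → LStepN n γ' γ'' → LStepN (n + 1) γ γ''

/-- `γ →L* γ'`. -/
def LStepStar : Cfg → Cfg → Prop := Relation.ReflTransGen LStep

/-- Final configurations: the computation is the empty computation `·`. -/
def Final (γ : Cfg) : Prop := γ.k = none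

/-! ### Executions -/

/-- A finite execution `γ0 →L γ1 →L ⋯ →L γn`. -/
structure FinExec (n : ℕ) where
  cfg : Fin (n + 1) → Cfg
  lbl : Fin n → Label
  step : ∀ i : Fin n, Step (lbl i) (cfg i.castSucc) (cfg i.succ)

/-- A (finite) execution is terminable if from some index onward every
configuration in it is final. -/
def FinExec.Terminable {n : ℕ} (σ : FinExec n) : Prop :=
  ∃ j : Fin (n + 1), ∀ j' : Fin (n + 1), j ≤ j' → Final (σ.cfg j')

/-! ### Matching logic -/

/-- Values of the model `T` (sorts relevant to valuations of logical variables). -/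
inductive Val where
  | int : ℤ → Val
  | env : Env → Val
  | mem : Mem → Val

def Val.toInt : Val → ℤ
  | Val.int n => n
  | _ => 0

/-- Valuations of the logical variables. -/
abbrev Vl := SVar → Val

/-- A matching logic pattern `∃X((o = c) ∧ φ)`:  a set of bound logical
variables, a configuration term (a function of valuations) and a constraint. -/
structure Pattern where
  bnd : Set SVar
  cfg : Vl → Cfg
  form : Vl → Prop

/-- `(γ,τ) ⊨ ∃X((o = c) ∧ φ)`. -/
def Sat (γ : Cfg) (τ : Vl) (Γ : Pattern) : Prop :=
  ∃ θ : Vl, (∀ v : SVar, v ∉ Γ.bnd → θ v = τ v) ∧ γ = Γ.cfg θ ∧ Γ.form θ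

/-- An assertion `⟨ρ⟩_env⟨m⟩_mem⟨X⟩_bnd⟨φ⟩_form`. -/
structure Assertion where
  bnd : Set SVar
  env : Vl → Env
  mem : Vl → Mem
  form : Vl → Prop

/-- The pattern `⟨k⟩_k ass`. -/
def Pattern.ofK (k : K) (a : Assertion) : Pattern :=
  { bnd := a.bnd, cfg := fun θ => ⟨k, a.env θ, a.mem θ⟩, form := a.form }

/-- The pattern `∃X(o = ⟨k⟩_k⟨ρ⟩_env⟨m⟩_mem ∧ φ)`. -/
def mkPat (X : Set SVar) (k : K) (ρ : Vl → Env) (m : Vl → Mem) (φ : Vl → Prop) :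
    Pattern :=
  { bnd := X, cfg := fun θ => ⟨k, ρ θ, m θ⟩, form := φ }

/-- Satisfaction of an assertion by an environment/memory pair. -/
def SatA (ρc : Env) (mc : Mem) (τ : Vl) (a : Assertion) : Prop :=
  ∃ θ : Vl, (∀ v : SVar, v ∉ a.bnd → θ v = τ v) ∧
    ρc = a.env θ ∧ mc = a.mem θ ∧ a.form θ

/-- Assertion entailment, `⊨ ⟨c⟩_k ass2 ⇒ ⟨c⟩_k ass1`. -/
def AssnEntail (a2 a1 : Assertion) : Prop :=
  ∀ (ρc : Env) (mc : Mem) (τ : Vl), SatA ρc mc τ a2 → SatA ρc mc τ a1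

/-! ### Proof outlines and interference-freedom (Definitions 4–6) -/

/-- A proof outline for a command: its pre/post assertions together with
pre/post assertions for each of its sub-computations. -/
structure Outline where
  pre : Assertion
  post : Assertion
  preOf : Com → Assertion
  postOf : Com → Assertion

/-- Sub-computations that are not within any `await`. -/
inductive SubNA : Com → Com → Prop where
  | refl (c : Com) : SubNA c c
  | condL {c c1 : Com} (b : BExp) (c2 : Com) : SubNA c c1 → SubNA c (Com.cond b c1 c2)
  | condR {c c2 : Com} (b : BExp) (c1 : Com) : SubNA c c2 → SubNA c (Com.cond b c1 c2)
  | seqL {c c1 : Com} (c2 : Com) : SubNA c c1 → SubNA c (Com.seq c1 c2)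
  | seqR {c c2 : Com} (c1 : Com) : SubNA c c2 → SubNA c (Com.seq c1 c2)
  | whileBody {c c1 : Com} (b : BExp) : SubNA c c1 → SubNA c (Com.whileDo b c1)
  | parL {c c1 : Com} (c2 : Com) : SubNA c c1 → SubNA c (Com.par c1 c2)
  | parR {c c2 : Com} (c1 : Com) : SubNA c c2 → SubNA c (Com.par c1 c2)

/-- `await` or assignment computations. -/
def IsAwaitOrAsgn : Com → Prop
  | Com.await _ _ => True
  | Com.assign _ _ => True
  | Com.arrRead _ _ _ => True
  | Com.arrWrite _ _ _ => True
  | Com.mkArray _ _ => True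
  | _ => False

/-- Definition 4: `k` (with pre-assertion `preK`) does not interfere with `c1`
(with proof outline `O1`). -/
def NoInterfere (k : Com) (preK : Assertion) (c1 : Com) (O1 : Outline) : Prop :=
  (∀ (γ γ' : Cfg) (τ : Vl),
      Sat γ τ (Pattern.ofK (some k) preK) →
      Sat γ τ (Pattern.ofK (some k) O1.post) →
      LStepStar γ γ' → Final γ' →
      Sat γ' τ (Pattern.ofK none O1.post)) ∧
  (∀ c1' : Com, SubNA c1' c1 →
    ∀ (γ γ' : Cfg) (τ : Vl),
      Sat γ τ (Pattern.ofK (some k) preK) →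
      Sat γ τ (Pattern.ofK (some k) (O1.preOf c1')) →
      LStepStar γ γ' → Final γ' →
      Sat γ' τ (Pattern.ofK none (O1.preOf c1')))

/-- Definition 5: `c1`, `c2` (with proof outlines `O1`, `O2`) are
interference-free. -/
def InterferenceFree (c1 : Com) (O1 : Outline) (c2 : Com) (O2 : Outline) : Prop :=
  (∀ k : Com, SubNA k c1 → IsAwaitOrAsgn k → NoInterfere k (O1.preOf k) c2 O2) ∧
  (∀ k : Com, SubNA k c2 → IsAwaitOrAsgn k → NoInterfere k (O2.preOf k) c1 O1)

/-- Definition 6: an actual execution of a configuration whose computation is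
`c` (with proof outline `O`): a terminable execution in which every
environment step is due to some computation executed in parallel with `c`
that is interference-free with `c`. -/
structure ActualExec (c : Com) (O : Outline) (n : ℕ) extends FinExec n where
  start : (cfg 0).k = some c
  terminable : FinExec.Terminable toFinExec
  envSrc : Fin n → Com × Outline
  ifree : ∀ i : Fin n, lbl i = Label.E →
    InterferenceFree (envSrc i).1 (envSrc i).2 c O

/-- A correctness pair `Γ ⇓ Γ'` is valid for actual executions. -/
def ValidActual (Γ Γ' : Pattern) : Prop :=
  ∀ (c : Com) (O : Outline) (n : ℕ) (σ : ActualExec c O n) (τ : Vl),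
    Sat (σ.cfg 0) τ Γ → Sat (σ.cfg (Fin.last n)) τ Γ'

/-! ### The matching logic proof system (Figure 3) -/

inductive Derivable : Pattern → Pattern → Prop where
  | skip (X : Set SVar) (ρ : Vl → Env) (m : Vl → Mem) (φ : Vl → Prop) :
      Derivable (mkPat X (some Com.skip) ρ m φ) (mkPat X none ρ m φ)
  | asgn1 (X : Set SVar) (x : PVar) (e : AExp) (ρ : Vl → Env) (m : Vl → Mem)
      (φ : Vl → Prop) :
      Derivable (mkPat X (some (Com.assign x e)) ρ m φ)
        (mkPat X none (fun θ => envUpd (ρ θ) x (aeval (ρ θ) e)) m φ)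
  | asgn2 (X : Set SVar) (x A : PVar) (e : AExp) (ρ : Vl → Env) (m : Vl → Mem)
      (φ : Vl → Prop) :
      Derivable (mkPat X (some (Com.arrRead x A e)) ρ m φ)
        (mkPat X none
          (fun θ => envUpd (ρ θ) x
            ((Option.map₂ (· + ·) ((ρ θ) A) (aeval (ρ θ) e)).bind (m θ)))
          m φ)
  | asgn3 (X : Set SVar) (A : PVar) (e1 e2 : AExp) (ρ : Vl → Env) (m : Vl → Mem)
      (φ : Vl → Prop) :
      Derivable (mkPat X (some (Com.arrWrite A e1 e2)) ρ m φ)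
        (mkPat X none ρ
          (fun θ => memUpdO (m θ)
            (Option.map₂ (· + ·) ((ρ θ) A) (aeval (ρ θ) e1)) (aeval (ρ θ) e2))
          φ)
  | array (X : Set SVar) (A : PVar) (es : List AExp) (p : SVar) (hp : p ∉ X)
      (ρ : Vl → Env) (m : Vl → Mem) (φ : Vl → Prop) :
      Derivable (mkPat X (some (Com.mkArray A es)) ρ m φ)
        (mkPat (X ∪ {p}) none
          (fun θ => envUpd (ρ θ) A (some ((θ p).toInt)))
          (fun θ => memStore (m θ) ((θ p).toInt) (es.map (aeval (ρ θ))))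
          φ)
  | seq (X1 X2 X3 : Set SVar) (c1 c2 : Com) (ρ1 ρ2 ρ3 : Vl → Env)
      (m1 m2 m3 : Vl → Mem) (φ1 φ2 φ3 : Vl → Prop) :
      Derivable (mkPat X1 (some c1) ρ1 m1 φ1) (mkPat X2 none ρ2 m2 φ2) →
      Derivable (mkPat X2 (some c2) ρ2 m2 φ2) (mkPat X3 none ρ3 m3 φ3) →
      Derivable (mkPat X1 (some (Com.seq c1 c2)) ρ1 m1 φ1)
        (mkPat X3 none ρ3 m3 φ3)
  | ifR (X1 X2 : Set SVar) (b : BExp) (c1 c2 : Com) (ρ ρ' : Vl → Env)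
      (m m' : Vl → Mem) (φ φ' : Vl → Prop) :
      Derivable
        (mkPat X1 (some c1) ρ m (fun θ => φ θ ∧ beval (ρ θ) b = some true))
        (mkPat X2 none ρ' m' φ') →
      Derivable
        (mkPat X1 (some c2) ρ m (fun θ => φ θ ∧ beval (ρ θ) b = some false))
        (mkPat X2 none ρ' m' φ') →
      Derivable (mkPat X1 (some (Com.cond b c1 c2)) ρ m φ)
        (mkPat X2 none ρ' m' φ')
  | cons (Γ Γ1 Γ1' Γ' : Pattern) :
      (∀ (γ : Cfg) (τ : Vl), Sat γ τ Γ → Sat γ τ Γ1) →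
      Derivable Γ1 Γ1' →
      (∀ (γ : Cfg) (τ : Vl), Sat γ τ Γ1' → Sat γ τ Γ') →
      Derivable Γ Γ'
  | case (Γ Γ1 Γ2 Γ' : Pattern) :
      (∀ (γ : Cfg) (τ : Vl), Sat γ τ Γ → Sat γ τ Γ1 ∨ Sat γ τ Γ2) →
      Derivable Γ1 Γ' → Derivable Γ2 Γ' →
      Derivable Γ Γ'
  | awaitR (X1 X2 : Set SVar) (b : BExp) (cc : Com) (hcc : IsCC cc)
      (ρ ρ' : Vl → Env) (m m' : Vl → Mem) (φ φ' : Vl → Prop) :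
      Derivable
        (mkPat X1 (some cc) ρ m (fun θ => φ θ ∧ beval (ρ θ) b = some true))
        (mkPat X2 none ρ' m' φ') →
      Derivable (mkPat X1 (some (Com.await b cc)) ρ m φ)
        (mkPat X2 none ρ' m' φ')
  | whileR (X : Set SVar) (b : BExp) (c : Com) (ρ : Vl → Env) (m : Vl → Mem)
      (φ : Vl → Prop) :
      Derivable
        (mkPat X (some c) ρ m (fun θ => φ θ ∧ beval (ρ θ) b = some true))
        (mkPat X none ρ m φ) →
      Derivable (mkPat X (some (Com.whileDo b c)) ρ m φ)
        (mkPat X none ρ m (fun θ => φ θ ∧ beval (ρ θ) b = some false))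
  | parR (X1 X2 : Set SVar) (c1 c2 : Com) (ρ ρ' : Vl → Env) (m m' : Vl → Mem)
      (φ1 φ2 φ1' φ2' : Vl → Prop) (O1 O2 : Outline)
      (hif : InterferenceFree c1 O1 c2 O2) :
      Derivable (mkPat X1 (some c1) ρ m φ1) (mkPat X2 none ρ' m' φ1') →
      Derivable (mkPat X1 (some c2) ρ m φ2) (mkPat X2 none ρ' m' φ2') →
      Derivable (mkPat X1 (some (Com.par c1 c2)) ρ m (fun θ => φ1 θ ∧ φ2 θ))
        (mkPat X2 none ρ' m' (fun θ => φ1' θ ∧ φ2' θ))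

/-! ### The matching logic verifier (Figure 4) -/

/-- Annotated computations: computations extended with `assert ass`. -/
inductive ACom where
  | skip : ACom
  | assign : PVar → AExp → ACom
  | arrRead : PVar → PVar → AExp → ACom
  | arrWrite : PVar → AExp → AExp → ACom
  | mkArray : PVar → List AExp → ACom
  | cond : BExp → ACom → ACom → ACom
  | seq : ACom → ACom → ACom
  | whileDo : BExp → ACom → ACom
  | par : ACom → ACom → ACom
  | await : BExp → ACom → ACom
  | assert : Assertion → ACom

def ACom.IsCC : ACom → Prop
  | ACom.cond _ c1 c2 => ACom.IsCC c1 ∧ ACom.IsCC c2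
  | ACom.seq c1 c2 => ACom.IsCC c1 ∧ ACom.IsCC c2
  | ACom.whileDo _ _ => False
  | ACom.par _ _ => False
  | ACom.await _ _ => False
  | _ => True

def kseq : K → K → K
  | none, k => k
  | some c, none => some c
  | some c, some d => some (Com.seq c d)

def toCom (k : K) : Com := k.getD Com.skip

/-- `k̄`: the computation obtained by removing all `assert ass` from `k`. -/
def erase : ACom → K
  | ACom.skip => some Com.skip
  | ACom.assign x e => some (Com.assign x e)
  | ACom.arrRead x A e => some (Com.arrRead x A e)
  | ACom.arrWrite A e1 e2 => some (Com.arrWrite A e1 e2)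
  | ACom.mkArray A es => some (Com.mkArray A es)
  | ACom.cond b c1 c2 => some (Com.cond b (toCom (erase c1)) (toCom (erase c2)))
  | ACom.seq c1 c2 => kseq (erase c1) (erase c2)
  | ACom.whileDo b c => some (Com.whileDo b (toCom (erase c)))
  | ACom.par c1 c2 => some (Com.par (toCom (erase c1)) (toCom (erase c2)))
  | ACom.await b c => some (Com.await b (toCom (erase c)))
  | ACom.assert _ => none

/-- Verifier patterns `⟨k⟩_k⟨ρ⟩_env⟨m⟩_mem⟨X⟩_bnd⟨φ⟩_form` (with an annotated
computation in the `k` cell). -/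
structure VPattern where
  k : Option ACom
  ass : Assertion

mutual

/-- One rewrite step of the matching logic verifier on a set of patterns. -/
inductive VStep : Multiset VPattern → Multiset VPattern → Prop where
  | null (a : Assertion) (S : Multiset VPattern) :
      VStep (⟨none, a⟩ ::ₘ S) S
  | vfalse (c1 c2 : ACom) (X : Set SVar) (ρ : Vl → Env) (m : Vl → Mem)
      (S : Multiset VPattern) :
      VStep (⟨some (ACom.seq c1 c2), ⟨X, ρ, m, fun _ => False⟩⟩ ::ₘ S) S
  | vskip (c : ACom) (a : Assertion) (S : Multiset VPattern) :
      VStep (⟨some (ACom.seq ACom.skip c), a⟩ ::ₘ S) (⟨some c, a⟩ ::ₘ S)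
  | vassert (ass1 ass2 : Assertion) (c : ACom) (S : Multiset VPattern)
      (h : AssnEntail ass2 ass1) :
      VStep (⟨some (ACom.seq (ACom.assert ass1) c), ass2⟩ ::ₘ S)
        (⟨some c, ass1⟩ ::ₘ S)
  | vasgn1 (x : PVar) (e : AExp) (c : ACom) (X : Set SVar) (ρ : Vl → Env)
      (m : Vl → Mem) (φ : Vl → Prop) (S : Multiset VPattern) :
      VStep (⟨some (ACom.seq (ACom.assign x e) c), ⟨X, ρ, m, φ⟩⟩ ::ₘ S)
        (⟨some c, ⟨X, fun θ => envUpd (ρ θ) x (aeval (ρ θ) e), m, φ⟩⟩ ::ₘ S)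
  | vasgn2 (x A : PVar) (e : AExp) (c : ACom) (X : Set SVar) (ρ : Vl → Env)
      (m : Vl → Mem) (φ : Vl → Prop) (S : Multiset VPattern) :
      VStep (⟨some (ACom.seq (ACom.arrRead x A e) c), ⟨X, ρ, m, φ⟩⟩ ::ₘ S)
        (⟨some c,
          ⟨X, fun θ => envUpd (ρ θ) x
              ((Option.map₂ (· + ·) ((ρ θ) A) (aeval (ρ θ) e)).bind (m θ)),
            m, φ⟩⟩ ::ₘ S)
  | vasgn3 (A : PVar) (e1 e2 : AExp) (c : ACom) (X : Set SVar) (ρ : Vl → Env)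
      (m : Vl → Mem) (φ : Vl → Prop) (S : Multiset VPattern) :
      VStep (⟨some (ACom.seq (ACom.arrWrite A e1 e2) c), ⟨X, ρ, m, φ⟩⟩ ::ₘ S)
        (⟨some c,
          ⟨X, ρ, fun θ => memUpdO (m θ)
              (Option.map₂ (· + ·) ((ρ θ) A) (aeval (ρ θ) e1)) (aeval (ρ θ) e2),
            φ⟩⟩ ::ₘ S)
  | varray (A : PVar) (es : List AExp) (c : ACom) (X : Set SVar) (p : SVar)
      (hp : p ∉ X) (ρ : Vl → Env) (m : Vl → Mem) (φ : Vl → Prop)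
      (S : Multiset VPattern) :
      VStep (⟨some (ACom.seq (ACom.mkArray A es) c), ⟨X, ρ, m, φ⟩⟩ ::ₘ S)
        (⟨some c,
          ⟨X ∪ {p}, fun θ => envUpd (ρ θ) A (some ((θ p).toInt)),
            fun θ => memStore (m θ) ((θ p).toInt) (es.map (aeval (ρ θ))), φ⟩⟩ ::ₘ S)
  | vif (b : BExp) (c1 c2 c3 : ACom) (X : Set SVar) (ρ : Vl → Env)
      (m : Vl → Mem) (φ : Vl → Prop) (S : Multiset VPattern) :
      VStep (⟨some (ACom.seq (ACom.cond b c1 c2) c3), ⟨X, ρ, m, φ⟩⟩ ::ₘ S)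
        (⟨some (ACom.seq c1 c3),
            ⟨X, ρ, m, fun θ => φ θ ∧ beval (ρ θ) b = some true⟩⟩ ::ₘ
         ⟨some (ACom.seq c2 c3),
            ⟨X, ρ, m, fun θ => φ θ ∧ beval (ρ θ) b = some false⟩⟩ ::ₘ S)
  | vwhile (b : BExp) (c1 c2 : ACom) (X : Set SVar) (ρ : Vl → Env)
      (m : Vl → Mem) (φ : Vl → Prop) (S : Multiset VPattern) :
      VStep (⟨some (ACom.seq (ACom.whileDo b c1) c2), ⟨X, ρ, m, φ⟩⟩ ::ₘ S)
        (⟨some (ACom.seq c1 (ACom.assert ⟨X, ρ, m, φ⟩)),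
            ⟨X, ρ, m, fun θ => φ θ ∧ beval (ρ θ) b = some true⟩⟩ ::ₘ
         ⟨some c2, ⟨X, ρ, m, fun θ => φ θ ∧ beval (ρ θ) b = some false⟩⟩ ::ₘ S)
  | vawait (b : BExp) (cc c2 : ACom) (hcc : ACom.IsCC cc) (X : Set SVar)
      (ρ : Vl → Env) (m : Vl → Mem) (φ : Vl → Prop) (S : Multiset VPattern) :
      VStep (⟨some (ACom.seq (ACom.await b cc) c2), ⟨X, ρ, m, φ⟩⟩ ::ₘ S)
        (⟨some (ACom.seq cc c2),
            ⟨X, ρ, m, fun θ => φ θ ∧ beval (ρ θ) b = some true⟩⟩ ::ₘ S)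
  | vpar (c1 c2 c3 : ACom) (X X' : Set SVar) (ρ ρ' : Vl → Env) (m m' : Vl → Mem)
      (φ1 φ2 φ1' φ2' : Vl → Prop) (O1 O2 : Outline) (S : Multiset VPattern)
      (hif : InterferenceFree (toCom (erase c1)) O1 (toCom (erase c2)) O2)
      (h1 : VSteps {⟨some c1, ⟨X, ρ, m, φ1⟩⟩} {⟨none, ⟨X', ρ', m', φ1'⟩⟩})
      (h2 : VSteps {⟨some c2, ⟨X, ρ, m, φ2⟩⟩} {⟨none, ⟨X', ρ', m', φ2'⟩⟩}) :
      VStep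
        (⟨some (ACom.seq (ACom.par c1 c2) c3),
            ⟨X, ρ, m, fun θ => φ1 θ ∧ φ2 θ⟩⟩ ::ₘ S)
        (⟨some (ACom.seq c1 (ACom.assert ⟨X', ρ', m', φ1'⟩)), ⟨X, ρ, m, φ1⟩⟩ ::ₘ
         ⟨some (ACom.seq c2 (ACom.assert ⟨X', ρ', m', φ2'⟩)), ⟨X, ρ, m, φ2⟩⟩ ::ₘ
         ⟨some c3, ⟨X', ρ', m', fun θ => φ1' θ ∧ φ2' θ⟩⟩ ::ₘ S)

/-- Reflexive-transitive closure of verifier rewriting. -/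
inductive VSteps : Multiset VPattern → Multiset VPattern → Prop where
  | refl (S : Multiset VPattern) : VSteps S S
  | head {S T U : Multiset VPattern} : VStep S T → VSteps T U → VSteps S U

end


/-- Dependent choice along a finite chain: a starting point satisfying the invariant `I` extends to
a whole chain whose consecutive members are related by `R`. -/
theorem exists_fin_chain {α : Type*} {n : ℕ} (I : Fin (n + 1) → α → Prop)
    (R : Fin n → α → α → Prop) (a : α) (ha : I 0 a)
    (h : ∀ (i : Fin n) (x : α), I i.castSucc x → ∃ y, I i.succ y ∧ R i x y) :
    ∃ p : Fin (n + 1) → α,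
      p 0 = a ∧ (∀ i, I i (p i)) ∧ ∀ i : Fin n, R i (p i.castSucc) (p i.succ) := by
  choose f hI hR using h
  let q : ∀ i : Fin (n + 1), {x : α // I i x} :=
    Fin.induction ⟨a, ha⟩ fun i x => ⟨f i x.1 x.2, hI i x.1 x.2⟩
  have hq (i : Fin n) : (q i.succ).1 = f i (q i.castSucc).1 (q i.castSucc).2 := by
    simp only [q, Fin.induction_succ]
  refine ⟨fun i => (q i).1, rfl, fun i => (q i).2, fun i => ?_⟩
  beta_reduce
  rw [hq i]
  exact hR i _ _

theorem parK_none_right (k : K) : parK k none = k := by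
  cases k <;> rfl

theorem parK_eq_none {k1 k2 : K} : parK k1 k2 = none ↔ k1 = none ∧ k2 = none := by
  cases k1 <;> cases k2 <;> simp [parK]

/-- The labels of the steps of two parallel components induced by a step with label `L` of their
composition: the components share environment steps, and one of them makes each program step. -/
def SplitLabel (L L1 L2 : Label) : Prop :=
  (L = Label.P → (L1 = Label.P ∧ L2 = Label.E) ∨ (L1 = Label.E ∧ L2 = Label.P)) ∧
    (L = Label.E → L1 = Label.E ∧ L2 = Label.E)

/-- A step of a parallel composition splits into one step of each component. -/
theorem Step.split_par {L : Label} {γ γ' : Cfg} (h : Step L γ γ') {k1 k2 : K}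
    (hk : γ.k = parK k1 k2) :
    ∃ (k1' k2' : K) (L1 L2 : Label), γ'.k = parK k1' k2' ∧
      Step L1 ⟨k1, γ.env, γ.mem⟩ ⟨k1', γ'.env, γ'.mem⟩ ∧
      Step L2 ⟨k2, γ.env, γ.mem⟩ ⟨k2', γ'.env, γ'.mem⟩ ∧ SplitLabel L L1 L2 := by
  obtain ⟨k, ρ, m⟩ := γ
  obtain ⟨k', ρ', m'⟩ := γ'
  dsimp only at hk ⊢
  cases L with
  | E =>
    cases h
    exact ⟨k1, k2, .E, .E, hk, .env _ _ _ _ _, .env _ _ _ _ _, by simp [SplitLabel]⟩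
  | P =>
    subst hk
    cases k1 with
    | none => exact ⟨none, k', .E, .P, rfl, .env _ _ _ _ _, h, by simp [SplitLabel]⟩
    | some a =>
      cases k2 with
      | none =>
        exact ⟨k', none, .P, .E, (parK_none_right k').symm, h, .env _ _ _ _ _,
          by simp [SplitLabel]⟩
      | some b =>
        cases h with
        | par1 _ h' =>
          exact ⟨_, some b, .P, .E, rfl, h', .env _ _ _ _ _, by simp [SplitLabel]⟩
        | par2 _ h' =>
          exact ⟨some a, _, .E, .P, rfl, .env _ _ _ _ _, h', by simp [SplitLabel]⟩

/-- Proposition 3: a terminable execution of `⟨c1 ∥ c2⟩_k⟨ρ⟩_env⟨m⟩_mem` can be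
broken down into two terminable executions of `⟨c1⟩_k⟨ρ⟩_env⟨m⟩_mem` and
`⟨c2⟩_k⟨ρ⟩_env⟨m⟩_mem`. -/
theorem par_decompose (c1 c2 : Com) (ρ : Env) (m : Mem) (n : ℕ) (σ : FinExec n)
    (hstart : σ.cfg 0 = ⟨some (Com.par c1 c2), ρ, m⟩)
    (hterm : σ.Terminable) :
    ∃ σ1 σ2 : FinExec n,
      σ1.cfg 0 = ⟨some c1, ρ, m⟩ ∧
      σ2.cfg 0 = ⟨some c2, ρ, m⟩ ∧
      σ1.Terminable ∧ σ2.Terminable ∧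
      (∀ i : Fin (n + 1),
        (σ1.cfg i).env = (σ.cfg i).env ∧ (σ2.cfg i).env = (σ.cfg i).env ∧
        (σ1.cfg i).mem = (σ.cfg i).mem ∧ (σ2.cfg i).mem = (σ.cfg i).mem ∧
        (σ.cfg i).k = parK (σ1.cfg i).k (σ2.cfg i).k) ∧
      (∀ i : Fin n,
        (σ.lbl i = Label.P →
          (σ1.lbl i = Label.P ∧ σ2.lbl i = Label.E) ∨
          (σ1.lbl i = Label.E ∧ σ2.lbl i = Label.P)) ∧
        (σ.lbl i = Label.E → σ1.lbl i = Label.E ∧ σ2.lbl i = Label.E)) := by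
  obtain ⟨p, hp0, hpk, hp⟩ := exists_fin_chain
    (fun i (q : K × K) => (σ.cfg i).k = parK q.1 q.2)
    (fun i q q' => ∃ L1 L2 : Label,
      Step L1 ⟨q.1, (σ.cfg i.castSucc).env, (σ.cfg i.castSucc).mem⟩
        ⟨q'.1, (σ.cfg i.succ).env, (σ.cfg i.succ).mem⟩ ∧
      Step L2 ⟨q.2, (σ.cfg i.castSucc).env, (σ.cfg i.castSucc).mem⟩
        ⟨q'.2, (σ.cfg i.succ).env, (σ.cfg i.succ).mem⟩ ∧
      SplitLabel (σ.lbl i) L1 L2)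
    (some c1, some c2) (by simp [hstart, parK])
    (fun i q hq => by
      obtain ⟨k1', k2', L1, L2, hk', h⟩ := (σ.step i).split_par hq
      exact ⟨(k1', k2'), hk', L1, L2, h⟩)
  choose L1 L2 h1 h2 hL using hp
  obtain ⟨j, hj⟩ := hterm
  have hfin (i : Fin (n + 1)) (hi : j ≤ i) : (p i).1 = none ∧ (p i).2 = none :=
    parK_eq_none.mp ((hpk i).symm.trans (hj i hi))
  exact ⟨⟨fun i => ⟨(p i).1, (σ.cfg i).env, (σ.cfg i).mem⟩, L1, h1⟩,
    ⟨fun i => ⟨(p i).2, (σ.cfg i).env, (σ.cfg i).mem⟩, L2, h2⟩,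
    by simp [hp0, hstart], by simp [hp0, hstart],
    ⟨j, fun i hi => (hfin i hi).1⟩, ⟨j, fun i hi => (hfin i hi).2⟩,
    fun i => ⟨rfl, rfl, rfl, rfl, hpk i⟩, hL⟩

end PIMP
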